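/- There is no nonconstant entire function f : ℂ → ℂ such that both 1 and −1 are totally ramified values of f of multiplicity at least 3; that is, there is no nonconstant entire f such that every z with f(z) = 1 satisfies f'(z) = 0 and f''(z) = 0, and every z with f(z) = −1 satisfies f'(z) = 0 and f''(z) = 0. (This is the analytic core of the paper's Corollary 2.2, that a homogeneous tree of valence ≥ 3 has no true form.) -/

import Mathlib

open Filter Topology

lemma entire_div (P Q : ℂ → ℂ) (hP : Differentiable ℂ P) (hQ : Differentiable ℂ Q)
    (hord : ∀ z, analyticOrderAt Q z ≠ ⊤ ∧ analyticOrderAt Q z ≤ analyticOrderAt P z) :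
    ∃ h : ℂ → ℂ, Differentiable ℂ h ∧ ∀ z, h z * Q z = P z := by
  have hPa : ∀ z, AnalyticAt ℂ P z := fun z => hP.analyticAt z
  have hQa : ∀ z, AnalyticAt ℂ Q z := fun z => hQ.analyticAt z
  have hm : MeromorphicOn (P / Q) Set.univ := fun z _ =>
    (hPa z).meromorphicAt.div (hQa z).meromorphicAt
  set N := toMeromorphicNFOn (P / Q) Set.univ with hN
  have hNF : MeromorphicNFOn N Set.univ := meromorphicNFOn_toMeromorphicNFOn _ _
  have hA : ∀ z, AnalyticAt ℂ N z := by
    intro z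
    rw [← (hNF (Set.mem_univ z)).meromorphicOrderAt_nonneg_iff_analyticAt, hN,
      meromorphicOrderAt_toMeromorphicNFOn hm (Set.mem_univ z),
      meromorphicOrderAt_div (hPa z).meromorphicAt (hQa z).meromorphicAt,
      (hPa z).meromorphicOrderAt_eq, (hQa z).meromorphicOrderAt_eq]
    obtain ⟨h1, h2⟩ := hord z
    revert h1 h2
    generalize analyticOrderAt Q z = b
    generalize analyticOrderAt P z = a
    intro h1 h2
    lift b to ℕ using h1
    induction a using ENat.recTopCoe with
    | top => simp
    | coe a =>
      have : b ≤ a := by exact_mod_cast h2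
      simp only [ENat.map_natCast]
      norm_cast
      omega
  refine ⟨N, fun z => (hA z).differentiableAt, fun z => ?_⟩
  have e1 := hm.toMeromorphicNFOn_eq_self_on_nhdsNE (Set.mem_univ z)
  have e2 : ∀ᶠ y in 𝓝[≠] z, Q y ≠ 0 := by
    rcases (hQa z).eventually_eq_zero_or_eventually_ne_zero with h | h
    · exact absurd (analyticOrderAt_eq_top.2 h) (hord z).1
    · exact h
  have e3 : ∀ᶠ y in 𝓝[≠] z, N y * Q y = P y := by
    filter_upwards [e1, e2] with y h1 h2
    rw [hN, h1]; simp [h2]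
  have c1 : Tendsto (fun y => N y * Q y) (𝓝[≠] z) (𝓝 (N z * Q z)) :=
    ((hA z).continuousAt.mul (hQa z).continuousAt).tendsto.mono_left nhdsWithin_le_nhds
  have c2 : Tendsto P (𝓝[≠] z) (𝓝 (P z)) :=
    (hPa z).continuousAt.tendsto.mono_left nhdsWithin_le_nhds
  exact tendsto_nhds_unique (c1.congr' e3) c2

lemma second_le (u d : ℝ → ℝ) (D : ℝ) (hmax : IsLocalMax u 0)
    (h1 : ∀ᶠ t in 𝓝 (0:ℝ), HasDerivAt u (d t) t) (h2 : HasDerivAt d D 0) : D ≤ 0 := by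
  by_contra! hD
  have e : deriv u =ᶠ[𝓝 0] d := h1.mono fun t ht => ht.deriv
  have hdd : deriv (deriv u) 0 = D := by rw [e.deriv_eq, h2.deriv]
  have hmin : IsLocalMin u 0 := isLocalMin_of_deriv_deriv_pos (by rw [hdd]; exact hD)
    hmax.deriv_eq_zero h1.self_of_nhds.continuousAt
  have hc : u =ᶠ[𝓝 0] fun _ => u 0 := by
    filter_upwards [hmax, hmin] with t a b using le_antisymm a b
  have e2 : deriv u =ᶠ[𝓝 0] fun _ => 0 := by
    have := hc.deriv
    simpa using this
  have := e2.deriv_eq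
  rw [hdd] at this
  simp at this
  linarith

lemma line_hasDeriv (z w : ℂ) (t : ℝ) : HasDerivAt (fun t : ℝ => z + (t:ℂ) * w) w t := by
  have := ((Complex.ofRealCLM.hasDerivAt (x := t)).mul_const w).const_add z
  simpa using this

lemma log_hasDeriv (g : ℂ → ℂ) (hg : Differentiable ℂ g) (z w : ℂ) (t : ℝ)
    (h0 : g (z + t * w) ≠ 0) :
    HasDerivAt (fun t : ℝ => Real.log ‖g (z + t * w)‖)
      ((w * (deriv g (z + t * w) / g (z + t * w))).re) t := by
  set p := z + t * w with hp
  have l := line_hasDeriv z w t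
  have hgl : HasDerivAt (fun s : ℝ => g (z + s * w)) (deriv g p * w) t := by
    have := HasDerivAt.comp_of_eq t (hg p).hasDerivAt l hp.symm
    exact this
  have hq : HasDerivAt (fun s : ℝ => Complex.log (g (z + s * w) / g p))
      ((deriv g p * w / g p) / (g p / g p)) t := by
    have := (hgl.div_const (g p)).clog_real (by rw [← hp, div_self h0]; simp)
    simpa [← hp] using this
  have hr : HasDerivAt (fun s : ℝ => (Complex.log (g (z + s * w) / g p)).re + Real.log ‖g p‖)
      ((deriv g p * w / g p) / (g p / g p)).re t := by
    have := (Complex.reCLM.hasFDerivAt.comp_hasDerivAt t hq).add_const (Real.log ‖g p‖)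
    simpa using this
  have hne : ∀ᶠ s : ℝ in 𝓝 t, g (z + s * w) ≠ 0 := hgl.continuousAt.eventually_ne h0
  have : ((deriv g p * w / g p) / (g p / g p)) = w * (deriv g p / g p) := by
    field_simp
  rw [this] at hr
  refine hr.congr_of_eventuallyEq ?_
  filter_upwards [hne] with s hs
  rw [Complex.log_re, norm_div, Real.log_div (by simpa using hs) (by simpa using h0)]
  ring

lemma dlog_hasDeriv (g : ℂ → ℂ) (hg : Differentiable ℂ g) (z w : ℂ) (h0 : g z ≠ 0) :
    HasDerivAt (fun t : ℝ => (w * (deriv g (z + t * w) / g (z + t * w))).re)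
      ((w * w * deriv (fun y => deriv g y / g y) z).re) 0 := by
  have l := line_hasDeriv z w 0
  have hd : DifferentiableAt ℂ (fun y => deriv g y / g y) z :=
    ((hg.analyticAt z).deriv.differentiableAt).div (hg z) h0
  have h1 := HasDerivAt.comp_of_eq (0:ℝ) hd.hasDerivAt l (by simp)
  have h2 := Complex.reCLM.hasFDerivAt.comp_hasDerivAt (0:ℝ) (h1.const_mul w)
  refine HasDerivAt.congr_deriv h2 ?_
  simp only [Complex.reCLM_apply]
  ring_nf

noncomputable def SS (x : ℝ) : ℝ := Real.log (1 + Real.exp (x/3))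
noncomputable def S1 (x : ℝ) : ℝ := Real.exp (x/3) / (1 + Real.exp (x/3)) / 3
noncomputable def S2 (x : ℝ) : ℝ := Real.exp (x/3) / (1 + Real.exp (x/3))^2 / 9

lemma SS_deriv (x : ℝ) : HasDerivAt SS (S1 x) x := by
  have h : HasDerivAt (fun x : ℝ => 1 + Real.exp (x/3)) (Real.exp (x/3) * (1/3)) x :=
    (((hasDerivAt_id x).div_const 3).exp).const_add 1
  have := h.log (by positivity)
  refine HasDerivAt.congr_deriv this ?_
  unfold S1; ring

lemma S1_deriv (x : ℝ) : HasDerivAt S1 (S2 x) x := by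
  have h0 : HasDerivAt (fun x : ℝ => Real.exp (x/3)) (Real.exp (x/3) * (1/3)) x :=
    (((hasDerivAt_id x).div_const 3).exp)
  have := (h0.div (h0.const_add 1) (by positivity)).div_const 3
  refine HasDerivAt.congr_deriv this ?_
  unfold S2; field_simp; ring

/-- the second order condition along one line -/
lemma line_ineq (h g k : ℂ → ℂ) (hh : Differentiable ℂ h) (hg : Differentiable ℂ g)
    (hk : Differentiable ℂ k) (R : ℝ) (z w : ℂ) (hw : ‖w‖ = 1) (h0 : h z ≠ 0)
    (g0 : g z ≠ 0) (k0 : k z ≠ 0) (hR : 0 < 1 - ‖z‖^2/R^2)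
    (hmax : IsLocalMax (fun y => 4 * Real.log ‖h y‖ + 3 * SS (Real.log ‖g y‖)
      + 3 * SS (Real.log ‖k y‖) + 12 * Real.log (1 - ‖y‖^2/R^2)) z) :
    4 * (w * w * deriv (fun y => deriv h y / h y) z).re
    + 3 * (S2 (Real.log ‖g z‖) * (w * (deriv g z / g z)).re * (w * (deriv g z / g z)).re
        + S1 (Real.log ‖g z‖) * (w * w * deriv (fun y => deriv g y / g y) z).re)
    + 3 * (S2 (Real.log ‖k z‖) * (w * (deriv k z / k z)).re * (w * (deriv k z / k z)).re
        + S1 (Real.log ‖k z‖) * (w * w * deriv (fun y => deriv k y / k y) z).re)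
    + 12 * (-(2/R^2) / (1 - ‖z‖^2/R^2)
        - (2 * (z.re * w.re + z.im * w.im) / R^2)^2 / (1 - ‖z‖^2/R^2)^2) ≤ 0 := by
  set B := z.re * w.re + z.im * w.im with hB
  have hN : ∀ t : ℝ, ‖z + t * w‖^2 = ‖z‖^2 + 2 * t * B + t^2 := by
    intro t
    have e : w.re^2 + w.im^2 = 1 := by
      have := Complex.sq_norm w
      rw [hw, Complex.normSq_apply] at this
      nlinarith
    rw [Complex.sq_norm, Complex.sq_norm, Complex.normSq_apply, Complex.normSq_apply]
    simp
    linear_combination t^2 * e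
  have hq : ∀ t : ℝ, HasDerivAt (fun t : ℝ => 1 - ‖z + t * w‖^2/R^2)
      (-((2 * B + 2 * t)/R^2)) t := by
    intro t
    simp only [hN]
    have h1 : HasDerivAt (fun t : ℝ => ‖z‖^2 + 2 * t * B + t^2) (2 * B + 2 * t) t := by
      have := ((((hasDerivAt_id t).const_mul 2).mul_const B).const_add (‖z‖^2)).add
        ((hasDerivAt_id t).pow 2)
      refine HasDerivAt.congr_deriv this ?_
      simp
    have := (h1.div_const (R^2)).const_sub 1
    simpa using this
  have lc : ContinuousAt (fun t : ℝ => z + (t:ℂ) * w) 0 := (line_hasDeriv z w 0).continuousAt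
  have ev : ∀ {m : ℂ → ℂ}, Differentiable ℂ m → m z ≠ 0 →
      ∀ᶠ t : ℝ in 𝓝 0, m (z + t * w) ≠ 0 := by
    intro m hm m0
    have : ContinuousAt (fun t : ℝ => m (z + t * w)) 0 :=
      ContinuousAt.comp (g := m) hm.continuous.continuousAt lc
    exact this.eventually_ne (by simpa using m0)
  refine second_le (fun t : ℝ => 4 * Real.log ‖h (z + t * w)‖ + 3 * SS (Real.log ‖g (z + t * w)‖)
      + 3 * SS (Real.log ‖k (z + t * w)‖) + 12 * Real.log (1 - ‖z + t * w‖^2/R^2))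
    (fun t : ℝ => 4 * (w * (deriv h (z + t * w) / h (z + t * w))).re
      + 3 * (S1 (Real.log ‖g (z + t * w)‖) * (w * (deriv g (z + t * w) / g (z + t * w))).re)
      + 3 * (S1 (Real.log ‖k (z + t * w)‖) * (w * (deriv k (z + t * w) / k (z + t * w))).re)
      + 12 * (-((2 * B + 2 * t)/R^2) / (1 - ‖z + t * w‖^2/R^2))) _ ?_ ?_ ?_
  · have : Tendsto (fun t : ℝ => z + (t:ℂ) * w) (𝓝 0) (𝓝 z) := by simpa using lc.tendsto
    have := this.eventually hmax
    filter_upwards [this] with t ht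
    simpa using ht
  · have e4 : ∀ᶠ t : ℝ in 𝓝 0, 0 < 1 - ‖z + t * w‖^2/R^2 :=
      (hq 0).continuousAt.eventually_const_lt (by simpa using hR)
    filter_upwards [ev hh h0, ev hg g0, ev hk k0, e4] with t a b c d
    refine (((HasDerivAt.const_mul 4 (log_hasDeriv h hh z w t a)).add
      (HasDerivAt.const_mul 3 ?_)).add (HasDerivAt.const_mul 3 ?_)).add
      (HasDerivAt.const_mul 12 ?_)
    · exact (SS_deriv _).comp t (log_hasDeriv g hg z w t b)
    · exact (SS_deriv _).comp t (log_hasDeriv k hk z w t c)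
    · exact (hq t).log d.ne'
  · have key : ∀ m : ℂ → ℂ, Differentiable ℂ m → m z ≠ 0 → HasDerivAt (fun t : ℝ =>
        S1 (Real.log ‖m (z + t * w)‖) * (w * (deriv m (z + t * w) / m (z + t * w))).re)
        (S2 (Real.log ‖m z‖) * (w * (deriv m z / m z)).re * (w * (deriv m z / m z)).re
        + S1 (Real.log ‖m z‖) * (w * w * deriv (fun y => deriv m y / m y) z).re) 0 := by
      intro m hm m0
      have a := (S1_deriv _).comp (0:ℝ) (log_hasDeriv m hm z w 0 (by simpa using m0))
      have := a.mul (dlog_hasDeriv m hm z w m0)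
      refine HasDerivAt.congr_deriv this ?_
      simp
    refine (((HasDerivAt.const_mul 4 (dlog_hasDeriv h hh z w h0)).add
      (HasDerivAt.const_mul 3 (key g hg g0))).add (HasDerivAt.const_mul 3 (key k hk k0))).add
      (HasDerivAt.const_mul 12 ?_)
    have n1 : HasDerivAt (fun t : ℝ => -((2 * B + 2 * t)/R^2)) (-(2/R^2)) 0 := by
      have := ((((hasDerivAt_id (0:ℝ)).const_mul 2).const_add (2*B)).div_const (R^2)).neg
      refine HasDerivAt.congr_deriv this ?_
      simp
    have := n1.div (hq 0) (by simpa using hR.ne')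
    refine HasDerivAt.congr_deriv this ?_
    simp
    field_simp

lemma lap_ineq (h f : ℂ → ℂ) (hh : Differentiable ℂ h) (hf : Differentiable ℂ f)
    (R : ℝ) (z : ℂ) (hR0 : 0 < R) (h0 : h z ≠ 0)
    (g0 : f z - 1 ≠ 0) (k0 : f z + 1 ≠ 0) (hR : 0 < 1 - ‖z‖^2/R^2)
    (hmax : IsLocalMax (fun y => 4 * Real.log ‖h y‖ + 3 * SS (Real.log ‖f y - 1‖)
      + 3 * SS (Real.log ‖f y + 1‖) + 12 * Real.log (1 - ‖y‖^2/R^2)) z) :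
    3 * S2 (Real.log ‖f z - 1‖) * (‖deriv f z‖^2 / ‖f z - 1‖^2)
    + 3 * S2 (Real.log ‖f z + 1‖) * (‖deriv f z‖^2 / ‖f z + 1‖^2)
    ≤ 48 / R^2 / (1 - ‖z‖^2/R^2)^2 := by
  have A := line_ineq h (fun y => f y - 1) (fun y => f y + 1) hh (hf.sub_const 1) (hf.add_const 1)
    R z 1 (by simp) h0 g0 k0 hR hmax
  have B := line_ineq h (fun y => f y - 1) (fun y => f y + 1) hh (hf.sub_const 1) (hf.add_const 1)
    R z Complex.I (by simp) h0 g0 k0 hR hmax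
  have d1 : ∀ y, deriv (fun y => f y - 1) y = deriv f y := fun y => deriv_sub_const ..
  have d2 : ∀ y, deriv (fun y => f y + 1) y = deriv f y := fun y => deriv_add_const ..
  simp only [d1, d2] at A B
  have n1 : ‖deriv f z‖^2 / ‖f z - 1‖^2 =
      (deriv f z / (f z - 1)).re^2 + (deriv f z / (f z - 1)).im^2 := by
    rw [← div_pow, ← norm_div, Complex.sq_norm, Complex.normSq_apply]; ring
  have n2 : ‖deriv f z‖^2 / ‖f z + 1‖^2 =
      (deriv f z / (f z + 1)).re^2 + (deriv f z / (f z + 1)).im^2 := by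
    rw [← div_pow, ← norm_div, Complex.sq_norm, Complex.normSq_apply]; ring
  have n3 : 48 / R^2 / (1 - ‖z‖^2/R^2)^2 = 12 * (2 * (2/R^2) / (1 - ‖z‖^2/R^2)
      + (2 * z.re / R^2)^2 / (1 - ‖z‖^2/R^2)^2 + (2 * z.im / R^2)^2 / (1 - ‖z‖^2/R^2)^2) := by
    have e : z.re^2 + z.im^2 = ‖z‖^2 := by
      rw [Complex.sq_norm, Complex.normSq_apply]; ring
    have : (2 * z.re / R^2)^2 / (1 - ‖z‖^2/R^2)^2 + (2 * z.im / R^2)^2 / (1 - ‖z‖^2/R^2)^2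
      = 4 * ‖z‖^2 / R^4 / (1 - ‖z‖^2/R^2)^2 := by
      rw [← e]; ring
    rw [add_assoc, this]
    generalize ‖z‖^2 = N at *
    have h2 : R^2 - N ≠ 0 := by
      intro h; have : N = R^2 := by linarith
      rw [this, div_self (by positivity)] at hR; simp at hR
    have h3 : 1 - N / R^2 = (R^2 - N)/R^2 := by field_simp
    rw [h3]
    field_simp
    ring
  rw [n1, n2, n3]
  simp only [one_mul, Complex.I_mul_I, neg_mul, Complex.neg_re, Complex.I_mul_re, Complex.one_re, Complex.one_im,
    Complex.I_re, Complex.I_im, mul_one, mul_zero, add_zero, zero_add] at A B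
  ring_nf at A B ⊢
  linarith

lemma alg1 (a b : ℝ) (ha : 0 < a) (hab : a ≤ b) (hb : 1 ≤ b) :
    (1+a)*(1+b) ≤ 64 * ((a/(1+a)^2/a^6 + b/(1+b)^2/b^6) * (a^4*b^4))^2 := by
  have hb0 : 0 < b := by linarith
  have h1 : b^4/(a*(1+a)^2) ≤ (a/(1+a)^2/a^6 + b/(1+b)^2/b^6) * (a^4*b^4) := by
    have : b^4/(a*(1+a)^2) = a/(1+a)^2/a^6 * (a^4*b^4) := by field_simp
    rw [this, add_mul]
    have : 0 ≤ b/(1+b)^2/b^6 * (a^4*b^4) := by positivity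
    linarith
  have h2 : (1+a)*(1+b) ≤ 64 * (b^4/(a*(1+a)^2))^2 := by
    rw [div_pow, mul_div_assoc', le_div_iff₀ (by positivity)]
    have e1 : (1+a) ≤ 2*b := by linarith
    have e2 : (1+b) ≤ 2*b := by linarith
    calc (1+a)*(1+b)*(a*(1+a)^2)^2 ≤ (2*b)*(2*b)*(b*(2*b)^2)^2 := by gcongr
      _ = 64 * (b^4)^2 := by ring
  refine h2.trans ?_
  gcongr

lemma alg2 (a b : ℝ) (ha : 0 < a) (hb : 0 < b) (h : 2 ≤ a^3 + b^3) :
    (1+a)*(1+b) ≤ 64 * ((a/(1+a)^2/a^6 + b/(1+b)^2/b^6) * (a^4*b^4))^2 := by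
  rcases le_total a b with hab | hab
  · refine alg1 a b ha hab ?_
    by_contra! hlt
    have : b^3 < 1 := pow_lt_one₀ hb.le hlt (by norm_num)
    have : a^3 ≤ b^3 := by gcongr
    linarith
  · have := alg1 b a hb hab ?_
    · calc _ = (1+b)*(1+a) := by ring
        _ ≤ _ := this
        _ = _ := by ring
    by_contra! hlt
    have : a^3 < 1 := pow_lt_one₀ ha.le hlt (by norm_num)
    have : b^3 ≤ a^3 := by gcongr
    linarith

noncomputable def cr (x : ℝ) : ℝ := x ^ (1/3 : ℝ)

lemma cr_nonneg {x : ℝ} (hx : 0 ≤ x) : 0 ≤ cr x := Real.rpow_nonneg hx _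

lemma cr_pow {x : ℝ} (hx : 0 ≤ x) : cr x ^ 3 = x := by
  unfold cr
  rw [← Real.rpow_natCast, ← Real.rpow_mul hx]; norm_num

lemma cr_exp {x : ℝ} (hx : 0 < x) : Real.exp (Real.log x / 3) = cr x := by
  unfold cr
  rw [Real.rpow_def_of_pos hx]; ring_nf

lemma cr_cont : Continuous cr := by
  unfold cr
  exact Real.continuous_rpow_const (by norm_num)

noncomputable def FF (h f : ℂ → ℂ) (R : ℝ) (y : ℂ) : ℝ :=
  ‖h y‖^4 * (1 + cr ‖f y - 1‖)^3 * (1 + cr ‖f y + 1‖)^3 * (1 - ‖y‖^2/R^2)^12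

lemma smooth_bound (h f : ℂ → ℂ) (hh : Differentiable ℂ h) (hf : Differentiable ℂ f)
    (heq : ∀ z, h z * ((f z - 1) * (f z + 1))^2 = deriv f z ^ 3)
    (R : ℝ) (z : ℂ) (hR0 : 0 < R) (h0 : h z ≠ 0)
    (g0 : f z - 1 ≠ 0) (k0 : f z + 1 ≠ 0) (hR : 0 < 1 - ‖z‖^2/R^2)
    (hmax : IsLocalMax (FF h f R) z) :
    FF h f R z ≤ (1152 / R^2)^6 := by
  have hcont : Continuous (fun y : ℂ => 1 - ‖y‖^2/R^2) := by fun_prop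
  have hmax' : IsLocalMax (fun y => 4 * Real.log ‖h y‖ + 3 * SS (Real.log ‖f y - 1‖)
      + 3 * SS (Real.log ‖f y + 1‖) + 12 * Real.log (1 - ‖y‖^2/R^2)) z := by
    have key : ∀ y, h y ≠ 0 → f y - 1 ≠ 0 → f y + 1 ≠ 0 → 0 < 1 - ‖y‖^2/R^2 →
        0 < FF h f R y ∧ 4 * Real.log ‖h y‖ + 3 * SS (Real.log ‖f y - 1‖)
      + 3 * SS (Real.log ‖f y + 1‖) + 12 * Real.log (1 - ‖y‖^2/R^2) = Real.log (FF h f R y) := by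
      intro y a b c d
      have a' := norm_pos_iff.2 a
      have b' := cr_nonneg (norm_nonneg (f y - 1))
      have c' := cr_nonneg (norm_nonneg (f y + 1))
      have p2 : 0 < 1 + cr ‖f y - 1‖ := by linarith
      have p3 : 0 < 1 + cr ‖f y + 1‖ := by linarith
      unfold FF SS
      rw [cr_exp (norm_pos_iff.2 b), cr_exp (norm_pos_iff.2 c)]
      refine ⟨by positivity, ?_⟩
      rw [Real.log_mul (by positivity) (by positivity), Real.log_mul (by positivity) (by positivity),
        Real.log_mul (by positivity) (by positivity)]
      simp only [Real.log_pow]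
      norm_num
    have e1 := hh.continuous.continuousAt.eventually_ne h0
    have e2 := (hf.sub_const 1).continuous.continuousAt.eventually_ne g0
    have e3 := (hf.add_const 1).continuous.continuousAt.eventually_ne k0
    have e4 := hcont.continuousAt.eventually_const_lt hR
    filter_upwards [hmax, e1, e2, e3, e4] with y hy a b c d
    rw [(key y a b c d).2, (key z h0 g0 k0 hR).2]
    exact Real.log_le_log (key y a b c d).1 hy
  have L := lap_ineq h f hh hf R z hR0 h0 g0 k0 hR hmax'
  unfold S2 at L
  rw [cr_exp (norm_pos_iff.2 g0), cr_exp (norm_pos_iff.2 k0)] at L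
  unfold FF
  have ga := cr_pow (norm_nonneg (f z - 1))
  have gb := cr_pow (norm_nonneg (f z + 1))
  have ha : 0 < cr ‖f z - 1‖ := Real.rpow_pos_of_pos (norm_pos_iff.2 g0) _
  have hb : 0 < cr ‖f z + 1‖ := Real.rpow_pos_of_pos (norm_pos_iff.2 k0) _
  have hab : 2 ≤ ‖f z - 1‖ + ‖f z + 1‖ := by
    have : ‖(f z + 1) - (f z - 1)‖ ≤ ‖f z + 1‖ + ‖f z - 1‖ := norm_sub_le _ _
    have e : (f z + 1) - (f z - 1) = 2 := by ring
    rw [e] at this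
    simp at this
    linarith
  have hq := congrArg norm (heq z)
  simp only [norm_mul, norm_pow] at hq
  generalize cr ‖f z - 1‖ = a at *
  generalize cr ‖f z + 1‖ = b at *
  rw [← ga, ← gb] at L hab hq
  generalize 1 - ‖z‖^2/R^2 = q at *
  generalize ‖deriv f z‖ = P at *
  have hY := alg2 a b ha hb hab
  set Y := (a/(1+a)^2/a^6 + b/(1+b)^2/b^6) * (a^4*b^4) with hYd
  have hY0 : 0 ≤ Y := by positivity
  have e1 : ‖h z‖ = (P/(a^2*b^2))^3 := by
    field_simp
    rw [← hq]; ring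
  have e2 : (P/(a^2*b^2))^2 * q^2 * Y ≤ 144 / R^2 := by
    have : 3 * ((P/(a^2*b^2))^2 * Y) = 9 * (3 * (a / (1 + a) ^ 2 / 9) * (P ^ 2 / (a ^ 3) ^ 2) +
      3 * (b / (1 + b) ^ 2 / 9) * (P ^ 2 / (b ^ 3) ^ 2)) := by
      rw [hYd]; field_simp
    rw [le_div_iff₀ (by positivity)] at L
    have : 3 * ((P/(a^2*b^2))^2 * q^2 * Y) ≤ 9 * (48/R^2) := by
      calc _ = (3 * ((P/(a^2*b^2))^2 * Y)) * q^2 := by ring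
        _ = _ := by rw [this]
        _ ≤ 9 * (48/R^2) := by rw [mul_assoc]; gcongr
    have e : 9 * (48/R^2) = 3 * (144 / R^2) := by ring
    linarith
  rw [e1]
  set E := P/(a^2*b^2)
  calc (E^3)^4 * (1+a)^3 * (1+b)^3 * q^12 = (E^2*q^2)^6 * ((1+a)*(1+b))^3 := by ring
    _ ≤ (E^2*q^2)^6 * (64 * Y^2)^3 := by gcongr
    _ = (8 * (E^2*q^2*Y))^6 := by ring
    _ ≤ (8 * (144 / R^2))^6 := by gcongr
    _ = _ := by ring

lemma deriv_ord (f : ℂ → ℂ) (hf : Differentiable ℂ f) (hnc : ∃ z w : ℂ, f z ≠ f w) (z : ℂ) :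
    analyticOrderAt (deriv f) z ≠ ⊤ := by
  intro h
  rw [analyticOrderAt_eq_top] at h
  have hd : AnalyticOnNhd ℂ (deriv f) Set.univ := fun y _ => (hf.analyticAt y).deriv
  have h0 := hd.eq_of_eventuallyEq (g := fun _ => 0) (fun y _ => analyticAt_const) h
  obtain ⟨a, b, hab⟩ := hnc
  exact hab (is_const_of_deriv_eq_zero hf (fun y => congrFun h0 y) a b)

lemma deriv_ord_ge (f : ℂ → ℂ) (hf : Differentiable ℂ f) (z : ℂ)
    (hz : deriv f z = 0 ∧ deriv (deriv f) z = 0) : 2 ≤ analyticOrderAt (deriv f) z := by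
  have hd := (hf.analyticAt z).deriv
  have := (natCast_le_analyticOrderAt_iff_iteratedDeriv_eq_zero (n := 2) hd).2 (by
    intro i hi
    interval_cases i
    · simpa using hz.1
    · simpa using hz.2)
  exact_mod_cast this

lemma ordQ (f : ℂ → ℂ) (hf : Differentiable ℂ f) (z : ℂ) (hz : f z = 1 ∨ f z = -1) :
    analyticOrderAt (fun y => ((f y - 1) * (f y + 1))^2) z
      = 2 * (analyticOrderAt (deriv f) z + 1) := by
  have a1 : AnalyticAt ℂ (fun y => f y - 1) z := (hf.sub_const 1).analyticAt z
  have a2 : AnalyticAt ℂ (fun y => f y + 1) z := (hf.add_const 1).analyticAt z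
  have e : (fun y => ((f y - 1) * (f y + 1))^2) = ((fun y => f y - 1) * (fun y => f y + 1))^2 := rfl
  rw [e, analyticOrderAt_pow (a1.mul a2), analyticOrderAt_mul a1 a2,
    (hf.analyticAt z).analyticOrderAt_deriv_add_one]
  rcases hz with hz | hz
  · have : analyticOrderAt (fun y => f y + 1) z = 0 := by
      rw [a2.analyticOrderAt_eq_zero, hz]; norm_num
    rw [this, hz]; simp
  · have : analyticOrderAt (fun y => f y - 1) z = 0 := by
      rw [a1.analyticOrderAt_eq_zero, hz]; norm_num
    rw [this, hz]; simp

lemma exists_h (f : ℂ → ℂ) (hf : Differentiable ℂ f) (hnc : ∃ z w : ℂ, f z ≠ f w)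
    (h1 : ∀ z : ℂ, f z = 1 → deriv f z = 0 ∧ deriv (deriv f) z = 0)
    (h2 : ∀ z : ℂ, f z = -1 → deriv f z = 0 ∧ deriv (deriv f) z = 0) :
    ∃ h : ℂ → ℂ, Differentiable ℂ h ∧
      ∀ z, h z * ((f z - 1) * (f z + 1))^2 = deriv f z ^ 3 := by
  have hQ : Differentiable ℂ (fun y => ((f y - 1) * (f y + 1))^2) := by fun_prop
  have hd : Differentiable ℂ (deriv f) := fun z => (hf.analyticAt z).deriv.differentiableAt
  have hP : Differentiable ℂ (fun y => deriv f y ^ 3) := hd.pow 3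
  refine entire_div (fun y => deriv f y ^ 3) _ hP hQ fun z => ?_
  by_cases hz : f z = 1 ∨ f z = -1
  · have hN := deriv_ord f hf hnc z
    have h2N := deriv_ord_ge f hf z (hz.elim (h1 z) (h2 z))
    have e : analyticOrderAt (fun y => deriv f y ^ 3) z = 3 * analyticOrderAt (deriv f) z := by
      have := analyticOrderAt_pow (hd.analyticAt z) 3
      rw [nsmul_eq_mul] at this; exact this
    rw [ordQ f hf z hz, e]
    revert hN h2N
    generalize analyticOrderAt (deriv f) z = N
    intro hN h2N
    lift N to ℕ using hN
    norm_cast at h2N ⊢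
    exact ⟨ENat.natCast_ne_top (2 * (N + 1)), by omega⟩
  · have : analyticOrderAt (fun y => ((f y - 1) * (f y + 1))^2) z = 0 := by
      rw [(hQ.analyticAt z).analyticOrderAt_eq_zero]
      push Not at hz
      refine pow_ne_zero _ (mul_ne_zero (sub_ne_zero.2 hz.1) ?_)
      intro h; exact hz.2 (eq_neg_of_add_eq_zero_left h)
    rw [this]; simp

lemma cusp_lower (h f : ℂ → ℂ) (hh : Differentiable ℂ h) (hf : Differentiable ℂ f)
    (hnc : ∃ z w : ℂ, f z ≠ f w)
    (heq : ∀ z, h z * ((f z - 1) * (f z + 1))^2 = deriv f z ^ 3)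
    (z : ℂ) (h0 : h z ≠ 0) (hz : f z = 1 ∨ f z = -1) :
    ∃ c > 0, ∀ᶠ y in 𝓝 z, c * ‖y - z‖ ≤ cr ‖f y - f z‖ := by
  have hQ : Differentiable ℂ (fun y => ((f y - 1) * (f y + 1))^2) := by fun_prop
  have hd : Differentiable ℂ (deriv f) := fun z => (hf.analyticAt z).deriv.differentiableAt
  have hN := deriv_ord f hf hnc z
  have e : analyticOrderAt (fun y => deriv f y ^ 3) z = 3 * analyticOrderAt (deriv f) z := by
    have := analyticOrderAt_pow (hd.analyticAt z) 3
    rw [nsmul_eq_mul] at this; exact this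
  have e2 : (fun y => deriv f y ^ 3) = h * (fun y => ((f y - 1) * (f y + 1))^2) :=
    funext fun y => (heq y).symm
  rw [e2, analyticOrderAt_mul (hh.analyticAt z) (hQ.analyticAt z), ordQ f hf z hz,
    (hh.analyticAt z).analyticOrderAt_eq_zero.2 h0] at e
  have e3 := (hf.analyticAt z).analyticOrderAt_deriv_add_one
  have e4 : analyticOrderAt (f · - f z) z = (3 : ℕ) := by
    rw [← e3]
    revert hN e
    generalize analyticOrderAt (deriv f) z = N
    intro hN e
    lift N to ℕ using hN
    norm_cast at e ⊢
    omega
  have a1 : AnalyticAt ℂ (fun y => f y - f z) z := (hf.sub_const _).analyticAt z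
  rw [a1.analyticOrderAt_eq_natCast] at e4
  obtain ⟨k, hk, k0, hfk⟩ := e4
  have kp : 0 < cr ‖k z‖ := Real.rpow_pos_of_pos (norm_pos_iff.2 k0) _
  have kc : ContinuousAt (fun y => cr ‖k y‖) z :=
    cr_cont.continuousAt.comp hk.continuousAt.norm
  refine ⟨cr ‖k z‖ / 2, by positivity, ?_⟩
  filter_upwards [hfk, kc.eventually_const_lt (show cr ‖k z‖ / 2 < cr ‖k z‖ by linarith)] with y h1 h2
  rw [h1]
  have : cr ‖(y - z)^3 • k y‖ = ‖y - z‖ * cr ‖k y‖ := by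
    unfold cr
    rw [norm_smul, norm_pow, Real.mul_rpow (by positivity) (by positivity),
      ← Real.rpow_natCast, ← Real.rpow_mul (by positivity)]
    norm_num
  rw [this, mul_comm]
  gcongr

lemma cusp_false (A Q : ℂ → ℝ) (z : ℂ) (c : ℝ) (hc : 0 < c) (hA0 : A z = 0)
    (hA : ∀ᶠ y in 𝓝 z, c * ‖y - z‖ ≤ A y) (hQ : DifferentiableAt ℝ Q z) (hQ0 : 0 < Q z)
    (hmax : IsLocalMax (fun y => (1 + A y)^3 * Q y) z) : False := by
  have lc : HasDerivAt (fun t : ℝ => z + (t:ℂ) * 1) 1 0 := line_hasDeriv z 1 0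
  have l0 : Tendsto (fun t : ℝ => z + (t:ℂ) * 1) (𝓝 0) (𝓝 z) := by
    simpa using lc.continuousAt.tendsto
  have hq : HasDerivAt (fun t : ℝ => Q (z + t * 1)) (fderiv ℝ Q z 1) 0 :=
    HasFDerivAt.comp_hasDerivAt_of_eq (0:ℝ) hQ.hasFDerivAt lc (by simp)
  set d := fderiv ℝ Q z 1
  have main : ∀ᶠ t : ℝ in 𝓝 0, (1 + c * |t|) * Q (z + t * 1) ≤ Q z := by
    have e1 := l0.eventually hA
    have e2 := l0.eventually hmax
    have e3 := l0.eventually (hQ.continuousAt.eventually_const_lt hQ0)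
    filter_upwards [e1, e2, e3] with t a b q
    simp only [hA0, add_zero, one_pow, one_mul] at b
    have a' : c * |t| ≤ A (z + t * 1) := by simpa using a
    have p : 0 ≤ c * |t| := by positivity
    refine le_trans ?_ b
    gcongr
    calc 1 + c * |t| ≤ 1 + A (z + t * 1) := by linarith
      _ ≤ (1 + A (z + t * 1))^3 := le_self_pow₀ (by linarith) (by norm_num)
  -- derivative d = 0 after combining; use two auxiliary functions
  have lin : ∀ s : ℝ, HasDerivAt (fun t : ℝ => (1 + s * t) * Q (z + t * 1)) (s * Q z + d) 0 := by
    intro s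
    have := (((hasDerivAt_id (0:ℝ)).const_mul s).const_add 1).mul hq
    refine HasDerivAt.congr_deriv this ?_
    simp
  have R1 : c * Q z + d ≤ 0 := by
    have h := (lin c).tendsto_slope_zero_right
    refine le_of_tendsto h ?_
    filter_upwards [main.filter_mono nhdsWithin_le_nhds, self_mem_nhdsWithin] with t ht hp
    have hp : 0 < t := hp
    rw [abs_of_pos hp] at ht
    simp only [smul_eq_mul, zero_add]
    refine mul_nonpos_of_nonneg_of_nonpos (by positivity) ?_
    simpa using ht
  have R2 : 0 ≤ -c * Q z + d := by
    have h := (lin (-c)).tendsto_slope_zero_left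
    refine ge_of_tendsto h ?_
    filter_upwards [main.filter_mono nhdsWithin_le_nhds, self_mem_nhdsWithin] with t ht hp
    have hp : t < 0 := hp
    rw [abs_of_neg hp] at ht
    simp only [smul_eq_mul, zero_add]
    refine mul_nonneg_of_nonpos_of_nonpos (inv_nonpos.2 hp.le) ?_
    simpa using ht
  have : 0 < c * Q z := by positivity
  linarith

lemma diff_cr (f : ℂ → ℂ) (hf : Differentiable ℂ f) (z : ℂ) (h : f z ≠ 0) :
    DifferentiableAt ℝ (fun y => (1 + cr ‖f y‖)^3) z := by
  have h1 : DifferentiableAt ℝ (fun y => ‖f y‖) z :=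
    ((hf z).restrictScalars ℝ).norm ℝ h
  have h2 : DifferentiableAt ℝ (fun y => cr ‖f y‖) z :=
    h1.rpow_const (Or.inl (by simpa using h))
  exact (h2.const_add 1).pow 3

lemma global_bound (h f : ℂ → ℂ) (hh : Differentiable ℂ h) (hf : Differentiable ℂ f)
    (hnc : ∃ z w : ℂ, f z ≠ f w)
    (heq : ∀ z, h z * ((f z - 1) * (f z + 1))^2 = deriv f z ^ 3)
    (R : ℝ) (hR0 : 0 < R) (x : ℂ) (hx : ‖x‖ ≤ R) :
    FF h f R x ≤ (1152 / R^2)^6 := by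
  have hcont : Continuous (FF h f R) := by
    unfold FF
    have := cr_cont
    have := hh.continuous
    have := hf.continuous
    fun_prop
  obtain ⟨z, hzm, hz⟩ := (isCompact_closedBall (0:ℂ) R).exists_isMaxOn ⟨x, by simpa using hx⟩
    hcont.continuousOn
  refine le_trans (hz (by simpa using hx : x ∈ Metric.closedBall (0:ℂ) R)) ?_
  by_cases hF : FF h f R z ≤ 0
  · exact hF.trans (by positivity)
  push Not at hF
  have hzR : ‖z‖ ≤ R := by simpa using hzm
  have hzR' : ‖z‖ < R := by
    refine lt_of_le_of_ne hzR fun e => ?_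
    unfold FF at hF
    rw [e, div_self (by positivity)] at hF
    simp at hF
  have hq : 0 < 1 - ‖z‖^2/R^2 := by
    rw [sub_pos, div_lt_one (by positivity)]
    gcongr
  have h0 : h z ≠ 0 := by
    intro e; unfold FF at hF; rw [e] at hF; simp at hF
  have hmax : IsLocalMax (FF h f R) z :=
    hz.isLocalMax (Filter.mem_of_superset (Metric.isOpen_ball.mem_nhds (by simpa using hzR'))
      Metric.ball_subset_closedBall)
  have dh : DifferentiableAt ℝ (fun y => ‖h y‖^4) z :=
    (((hh z).restrictScalars ℝ).norm ℝ h0).pow 4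
  have dq : DifferentiableAt ℝ (fun y : ℂ => (1 - ‖y‖^2/R^2)^12) z := by
    have : DifferentiableAt ℝ (fun y : ℂ => ‖y‖^2) z := differentiableAt_id.norm_sq ℝ
    simp only [div_eq_mul_inv]
    exact ((this.mul_const _).const_sub 1).pow 12
  have hp : 0 < ‖h z‖ := norm_pos_iff.2 h0
  by_cases c1 : f z = 1
  · exfalso
    obtain ⟨c, hc, hlow⟩ := cusp_lower h f hh hf hnc heq z h0 (Or.inl c1)
    rw [c1] at hlow
    have k0 : f z + 1 ≠ 0 := by rw [c1]; norm_num
    have hcp := cr_nonneg (norm_nonneg (f z + 1))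
    refine cusp_false (fun y => cr ‖f y - 1‖)
      (fun y => ‖h y‖^4 * (1 + cr ‖f y + 1‖)^3 * (1 - ‖y‖^2/R^2)^12) z c hc
      (by simp [c1, cr]) hlow ((dh.mul (diff_cr _ (hf.add_const 1) z k0)).mul dq) (by positivity) ?_
    have : FF h f R = fun y => (1 + cr ‖f y - 1‖)^3 *
      (‖h y‖^4 * (1 + cr ‖f y + 1‖)^3 * (1 - ‖y‖^2/R^2)^12) := by
      funext y; unfold FF; ring
    rw [← this]; exact hmax
  by_cases c2 : f z = -1
  · exfalso
    obtain ⟨c, hc, hlow⟩ := cusp_lower h f hh hf hnc heq z h0 (Or.inr c2)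
    rw [c2] at hlow
    simp only [sub_neg_eq_add] at hlow
    have k0 : f z - 1 ≠ 0 := by rw [c2]; norm_num
    have hcp := cr_nonneg (norm_nonneg (f z - 1))
    refine cusp_false (fun y => cr ‖f y + 1‖)
      (fun y => ‖h y‖^4 * (1 + cr ‖f y - 1‖)^3 * (1 - ‖y‖^2/R^2)^12) z c hc
      (by simp [c2, cr]) hlow ((dh.mul (diff_cr _ (hf.sub_const 1) z k0)).mul dq) (by positivity) ?_
    have : FF h f R = fun y => (1 + cr ‖f y + 1‖)^3 *
      (‖h y‖^4 * (1 + cr ‖f y - 1‖)^3 * (1 - ‖y‖^2/R^2)^12) := by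
      funext y; unfold FF; ring
    rw [← this]; exact hmax
  exact smooth_bound h f hh hf heq R z hR0 h0 (sub_ne_zero.2 c1)
    (fun e => c2 (eq_neg_of_add_eq_zero_left e)) hq hmax

/-- There is no nonconstant entire function `f : ℂ → ℂ` such that both `1` and `-1`
are totally ramified values of multiplicity at least `3`:
every preimage of `1` (resp. `-1`) is a zero of `f'` and `f''`. -/
theorem no_entire_with_two_totally_ramified_values_of_mult_three
    (f : ℂ → ℂ) (hf : Differentiable ℂ f)
    (hnc : ∃ z w : ℂ, f z ≠ f w)
    (h1 : ∀ z : ℂ, f z = 1 → deriv f z = 0 ∧ deriv (deriv f) z = 0)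
    (h2 : ∀ z : ℂ, f z = -1 → deriv f z = 0 ∧ deriv (deriv f) z = 0) :
    False := by
  obtain ⟨h, hh, heq⟩ := exists_h f hf hnc h1 h2
  have hz : ∀ x, h x = 0 := by
    intro x
    have t0 : Tendsto (fun R : ℝ => R^2) atTop atTop := tendsto_pow_atTop (by norm_num)
    have t1 : Tendsto (fun R : ℝ => (1152 / R^2)^6) atTop (𝓝 0) := by
      have := (t0.const_div_atTop 1152).pow 6
      simpa using this
    have t2 : Tendsto (fun R : ℝ => FF h f R x) atTop
        (𝓝 (‖h x‖^4 * (1 + cr ‖f x - 1‖)^3 * (1 + cr ‖f x + 1‖)^3)) := by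
      have := (((t0.const_div_atTop (‖x‖^2)).const_sub 1).pow 12).const_mul
        (‖h x‖^4 * (1 + cr ‖f x - 1‖)^3 * (1 + cr ‖f x + 1‖)^3)
      simpa [FF] using this
    have le := le_of_tendsto_of_tendsto t2 t1 (by
      filter_upwards [eventually_gt_atTop 0, eventually_ge_atTop ‖x‖] with R hR hx
      exact global_bound h f hh hf hnc heq R hR x hx)
    by_contra hne
    have p1 := norm_pos_iff.2 hne
    have p2 := cr_nonneg (norm_nonneg (f x - 1))
    have p3 := cr_nonneg (norm_nonneg (f x + 1))
    have : 0 < ‖h x‖^4 * (1 + cr ‖f x - 1‖)^3 * (1 + cr ‖f x + 1‖)^3 := by positivity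
    linarith
  obtain ⟨a, b, hab⟩ := hnc
  refine hab (is_const_of_deriv_eq_zero hf (fun y => ?_) a b)
  have := heq y
  rw [hz y, zero_mul] at this
  exact pow_eq_zero_iff (by norm_num) |>.1 this.symm
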